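/- arXiv:2002.10814 — 2 statements merged into one kernel-verified Lean document; each statement's English description precedes it below -/
import Mathlib

section
/- The partial failure trace preorder ⊑*_FT is a precongruence for the operators of CCSP^g_t: for every unary recursion-free CCSP^g_t-context C, if fft(P) ⊇ fft(Q) then fft(C[P]) ⊇ fft(C[Q]). -/
/-! ### The process algebras CCSP_t and CCSP^g_t

The countably infinite set `A` of visible actions and the countably infinite set `V`
of variables are both taken to be `ℕ`.  Besides the operators of CCSP_t, the syntax
below also provides guarded sums `Σ_{i=1}^n αᵢ.Eᵢ` with `n ∈ ℕ ∪ {∞}` (represented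
as partial functions `ℕ → Option (Act × Expr)`); the CCSP^g_t expressions are those
not containing the binary choice `+`. -/

/-- Actions: visible actions from `A = ℕ`, the hidden action `τ`,
and the time-out action `t`. -/
inductive Act : Type
  | act : ℕ → Act
  | tau : Act
  | timeout : Act

/-- CCSP_t expressions.  A recursive specification `S` is represented as a partial
function `ℕ → Option Expr`; its domain is the set `V_S` of bound variables, and
`⟨X|S⟩` is written `Expr.fix X S`. -/
inductive Expr : Type
  | nil : Expr
  | pre : Act → Expr → Expr
  | choice : Expr → Expr → Expr
  | par : Set ℕ → Expr → Expr → Expr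
  | abs : Set ℕ → Expr → Expr
  | ren : Set (ℕ × ℕ) → Expr → Expr
  | var : ℕ → Expr
  | fix : ℕ → (ℕ → Option Expr) → Expr
  | gsum : (ℕ → Option (Act × Expr)) → Expr

/-- `α.notIn S`: the action `α` is not a visible action belonging to `S ⊆ A`. -/
def Act.notIn (α : Act) (S : Set ℕ) : Prop := ∀ a : ℕ, α = Act.act a → a ∉ S

/-- Relational substitution: `Subst ρ E E'` holds iff `E'` is the result of replacing,
in `E`, every free occurrence of each variable `Y` in the domain of `ρ` by the
expression `ρ Y` (occurrences bound by an inner recursion are not replaced). -/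
inductive Subst : (ℕ → Option Expr) → Expr → Expr → Prop
  | nil {ρ} : Subst ρ .nil .nil
  | pre {ρ α E E'} : Subst ρ E E' → Subst ρ (.pre α E) (.pre α E')
  | choice {ρ E F E' F'} : Subst ρ E E' → Subst ρ F F' →
      Subst ρ (.choice E F) (.choice E' F')
  | par {ρ S E F E' F'} : Subst ρ E E' → Subst ρ F F' →
      Subst ρ (.par S E F) (.par S E' F')
  | abs {ρ I E E'} : Subst ρ E E' → Subst ρ (.abs I E) (.abs I E')
  | ren {ρ R E E'} : Subst ρ E E' → Subst ρ (.ren R E) (.ren R E')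
  | varNone {ρ Y} : ρ Y = none → Subst ρ (.var Y) (.var Y)
  | varSome {ρ Y F} : ρ Y = some F → Subst ρ (.var Y) F
  | gsum {ρ} {f f' : ℕ → Option (Act × Expr)} :
      (∀ i, f i = none ↔ f' i = none) →
      (∀ i α E α' E', f i = some (α, E) → f' i = some (α', E') → α' = α) →
      (∀ i α E α' E', f i = some (α, E) → f' i = some (α', E') → Subst ρ E E') →
      Subst ρ (.gsum f) (.gsum f')
  | fix {ρ Z} {T T' : ℕ → Option Expr} :
      (∀ Y, T Y = none ↔ T' Y = none) →
      (∀ Y E E', T Y = some E → T' Y = some E' →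
          Subst (fun W => if (T W).isSome then none else ρ W) E E') →
      Subst ρ (.fix Z T) (.fix Z T')

/-- The substitution replacing each bound variable `Y` of `S` by `⟨Y|S⟩`. -/
def recmap (S : ℕ → Option Expr) : ℕ → Option Expr :=
  fun Y => (S Y).map (fun _ => Expr.fix Y S)

/-- The structural operational (interleaving) semantics of CCSP_t. -/
inductive Step : Expr → Act → Expr → Prop
  | pre {α E} : Step (.pre α E) α E
  | choiceL {E F α E'} : Step E α E' → Step (.choice E F) α E'
  | choiceR {E F α F'} : Step F α F' → Step (.choice E F) α F'
  | renTau {R E E'} : Step E .tau E' → Step (.ren R E) .tau (.ren R E')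
  | renTimeout {R E E'} : Step E .timeout E' →
      Step (.ren R E) .timeout (.ren R E')
  | renAct {R E E' a b} : Step E (.act a) E' → (a, b) ∈ R →
      Step (.ren R E) (.act b) (.ren R E')
  | parL {S E F α E'} : Step E α E' → α.notIn S →
      Step (.par S E F) α (.par S E' F)
  | parR {S E F α F'} : Step F α F' → α.notIn S →
      Step (.par S E F) α (.par S E F')
  | parSync {S E F a E' F'} : Step E (.act a) E' → Step F (.act a) F' → a ∈ S →
      Step (.par S E F) (.act a) (.par S E' F')
  | absFree {I E α E'} : Step E α E' → α.notIn I →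
      Step (.abs I E) α (.abs I E')
  | absHide {I E a E'} : Step E (.act a) E' → a ∈ I →
      Step (.abs I E) .tau (.abs I E')
  | fixUnfold {X S E E' α F} : S X = some E → Subst (recmap S) E E' →
      Step E' α F → Step (.fix X S) α F
  | gsum {f : ℕ → Option (Act × Expr)} {i α E} : f i = some (α, E) →
      Step (.gsum f) α E

/-- Free occurrence of a variable in a CCSP_t expression. -/
inductive Free (x : ℕ) : Expr → Prop
  | pre {α E} : Free x E → Free x (.pre α E)
  | choiceL {E F} : Free x E → Free x (.choice E F)
  | choiceR {E F} : Free x F → Free x (.choice E F)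
  | parL {S E F} : Free x E → Free x (.par S E F)
  | parR {S E F} : Free x F → Free x (.par S E F)
  | abs {I E} : Free x E → Free x (.abs I E)
  | ren {R E} : Free x E → Free x (.ren R E)
  | var : Free x (.var x)
  | fix {Z T Y E} : T Y = some E → Free x E → T x = none → Free x (.fix Z T)
  | gsum {f : ℕ → Option (Act × Expr)} {i α E} : f i = some (α, E) → Free x E →
      Free x (.gsum f)

/-- An expression is closed if no variable occurs free in it. -/
def Closed (E : Expr) : Prop := ∀ x, ¬ Free x E

/-- Well-formedness: in every recursion `⟨X|S⟩` occurring in the expression the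
variable `X` is bound by `S`, and every relational renaming occurring in it has
finite images `{b | (a,b) ∈ R}`. -/
inductive WF : Expr → Prop
  | nil : WF .nil
  | pre {α E} : WF E → WF (.pre α E)
  | choice {E F} : WF E → WF F → WF (.choice E F)
  | par {S E F} : WF E → WF F → WF (.par S E F)
  | abs {I E} : WF E → WF (.abs I E)
  | ren {R E} : (∀ a : ℕ, {b | (a, b) ∈ R}.Finite) → WF E → WF (.ren R E)
  | var {X} : WF (.var X)
  | fix {X T} : (T X).isSome → (∀ Y E, T Y = some E → WF E) → WF (.fix X T)
  | gsum {f : ℕ → Option (Act × Expr)} : (∀ i α E, f i = some (α, E) → WF E) →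
      WF (.gsum f)

/-- `ℙ`: a process is a closed well-formed CCSP_t expression. -/
def IsProcess (E : Expr) : Prop := Closed E ∧ WF E

/-- A process is stable if it has no outgoing τ-transitions. -/
def stable (P : Expr) : Prop := ¬ ∃ P', Step P .tau P'

/-- The set `I(P)` of initial visible actions of a process. -/
def initials (P : Expr) : Set ℕ := {a | ∃ P', Step P (.act a) P'}

/-- CCSP^g_t expressions: the binary choice operator `+` does not occur. -/
inductive NoPlus : Expr → Prop
  | nil : NoPlus .nil
  | pre {α E} : NoPlus E → NoPlus (.pre α E)
  | par {S E F} : NoPlus E → NoPlus F → NoPlus (.par S E F)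
  | abs {I E} : NoPlus E → NoPlus (.abs I E)
  | ren {R E} : NoPlus E → NoPlus (.ren R E)
  | var {X} : NoPlus (.var X)
  | fix {Z T} : (∀ Y E, T Y = some E → NoPlus E) → NoPlus (.fix Z T)
  | gsum {f : ℕ → Option (Act × Expr)} : (∀ i α E, f i = some (α, E) → NoPlus E) →
      NoPlus (.gsum f)

/-! ### Partial failure traces -/

/-- An element of a partial failure trace: a visible action `a ∈ A`
or a refusal set `X ⊆ A`. -/
abbrev Elt : Type := Sum ℕ (Set ℕ)

/-- Partial failure traces: sequences over `A ∪ 𝒫(A)`; the final tag `⊤` is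
left implicit. -/
abbrev PFT : Type := List Elt

/-- The set of partial failure traces of a process (Table 3). -/
inductive fft : Expr → PFT → Prop
  | top {P} : fft P []
  | act {P Q a ρ} : Step P (.act a) Q → fft Q ρ → fft P (Sum.inl a :: ρ)
  | tau {P Q ρ} : Step P .tau Q → fft Q ρ → fft P ρ
  | refusal {P X ρ} : (∀ a ∈ X, a ∉ initials P) → stable P → fft P ρ →
      fft P (Sum.inr X :: ρ)
  | timeoutRef {P Q X ρ} : (∀ a ∈ X, a ∉ initials P) → stable P →
      Step P .timeout Q → fft Q (Sum.inr X :: ρ) → fft P (Sum.inr X :: ρ)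
  | timeoutAct {P Q X a ρ} : (∀ a' ∈ X, a' ∉ initials P) → stable P →
      Step P .timeout Q → fft Q (Sum.inl a :: ρ) → a ∈ X →
      fft P (Sum.inr X :: Sum.inl a :: ρ)

def fftSet (P : Expr) : Set PFT := {σ | fft P σ}

/-! ### Unary recursion-free CCSP^g_t-contexts -/

/-- Unary recursion-free CCSP^g_t-contexts: expressions built from a hole and the
operators guarded sum, `∥_S`, `τ_I` and renaming of CCSP^g_t, with expressions as
further arguments.  In `GCtx.gsum f α C` the hole occurs in the summand `α.C`,
next to the further summands given by `f`. -/
inductive GCtx : Type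
  | hole : GCtx
  | gsum : (ℕ → Option (Act × Expr)) → Act → GCtx → GCtx
  | parL : Set ℕ → GCtx → Expr → GCtx
  | parR : Set ℕ → Expr → GCtx → GCtx
  | abs : Set ℕ → GCtx → GCtx
  | ren : Set (ℕ × ℕ) → GCtx → GCtx

/-- `C.fill P = C[P]`: the process obtained by filling the hole with `P`. -/
def GCtx.fill : GCtx → Expr → Expr
  | .hole, P => P
  | .gsum f α C, P => .gsum (fun i => Nat.casesOn i (some (α, C.fill P)) f)
  | .parL S C Q, P => .par S (C.fill P) Q
  | .parR S Q C, P => .par S Q (C.fill P)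
  | .abs I C, P => .abs I (C.fill P)
  | .ren R C, P => .ren R (C.fill P)

/-- The further arguments of the context are closed CCSP^g_t processes, and all
renaming operators in the context have finite images. -/
inductive GCtx.OK : GCtx → Prop
  | hole : GCtx.OK .hole
  | gsum {f : ℕ → Option (Act × Expr)} {α C} :
      (∀ i β E, f i = some (β, E) → IsProcess E ∧ NoPlus E) → GCtx.OK C →
      GCtx.OK (.gsum f α C)
  | parL {S C Q} : GCtx.OK C → IsProcess Q → NoPlus Q → GCtx.OK (.parL S C Q)
  | parR {S Q C} : IsProcess Q → NoPlus Q → GCtx.OK C → GCtx.OK (.parR S Q C)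
  | abs {I C} : GCtx.OK C → GCtx.OK (.abs I C)
  | ren {R C} : (∀ a : ℕ, {b | (a, b) ∈ R}.Finite) → GCtx.OK C → GCtx.OK (.ren R C)

/-! ### Refusals and case analysis of partial failure traces -/

/-- `P` is stable and refuses all actions in `X`. -/
def Refuses (P : Expr) (X : Set ℕ) : Prop := stable P ∧ ∀ a ∈ X, a ∉ initials P

theorem Act.tau_notIn (S : Set ℕ) : Act.tau.notIn S := fun _ h => by cases h

theorem Act.timeout_notIn (S : Set ℕ) : Act.timeout.notIn S := fun _ h => by cases h

theorem Act.act_notIn {a : ℕ} {S : Set ℕ} : (Act.act a).notIn S ↔ a ∉ S :=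
  ⟨fun h => h a rfl, fun h b hb => by cases hb; exact h⟩

theorem fft.act_induction {M : Expr → Prop} {a : ℕ} {ρ : PFT}
    (tau : ∀ P Q, Step P .tau Q → M Q → M P)
    (act : ∀ P Q, Step P (.act a) Q → fft Q ρ → M P)
    {P : Expr} (h : fft P (Sum.inl a :: ρ)) : M P := by
  generalize hσ : (Sum.inl a :: ρ : PFT) = σ at h
  induction h with
  | top => cases hσ
  | act hs hf => cases hσ; exact act _ _ hs hf
  | tau hs _ ih => exact tau _ _ hs (ih hσ)
  | refusal => cases hσ
  | timeoutRef => cases hσ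
  | timeoutAct => cases hσ

theorem fft.refusal_induction {M : Expr → Prop} {X : Set ℕ} {ρ : PFT}
    (tau : ∀ P Q, Step P .tau Q → M Q → M P)
    (refusal : ∀ P, Refuses P X → fft P ρ → M P)
    (timeoutRef : ∀ P Q, Refuses P X → Step P .timeout Q → M Q → M P)
    (timeoutAct : ∀ P Q a ρ', Refuses P X → Step P .timeout Q → fft Q ρ →
      ρ = Sum.inl a :: ρ' → a ∈ X → M P)
    {P : Expr} (h : fft P (Sum.inr X :: ρ)) : M P := by
  generalize hσ : (Sum.inr X :: ρ : PFT) = σ at h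
  induction h with
  | top => cases hσ
  | act => cases hσ
  | tau hs _ ih => exact tau _ _ hs (ih hσ)
  | refusal hr hst hf => cases hσ; exact refusal _ ⟨hst, hr⟩ hf
  | timeoutRef hr hst hs _ ih => cases hσ; exact timeoutRef _ _ ⟨hst, hr⟩ hs (ih rfl)
  | timeoutAct hr hst hs hf ha =>
    cases hσ; exact timeoutAct _ _ _ _ ⟨hst, hr⟩ hs hf rfl ha

theorem Refuses.not_fft {P : Expr} {X : Set ℕ} {a : ℕ} {ρ : PFT} (h : Refuses P X)
    (ha : a ∈ X) : ¬ fft P (Sum.inl a :: ρ) := fun hf =>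
  hf.act_induction (M := fun P => ¬ Refuses P X)
    (fun _ _ hs _ hr => hr.1 ⟨_, hs⟩) (fun _ _ hs _ hr => hr.2 a ha ⟨_, hs⟩) h

/-! ### Renaming -/

/-- The actions that `R` renames into an action of `X`. -/
def renPreimage (R : Set (ℕ × ℕ)) (X : Set ℕ) : Set ℕ := {a | ∃ b ∈ X, (a, b) ∈ R}

theorem refuses_ren_iff {R : Set (ℕ × ℕ)} {P : Expr} {X : Set ℕ} :
    Refuses (.ren R P) X ↔ Refuses P (renPreimage R X) := by
  constructor
  · rintro ⟨hst, hr⟩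
    refine ⟨fun ⟨P', hs⟩ => hst ⟨_, .renTau hs⟩, ?_⟩
    rintro a ⟨b, hb, hab⟩ ⟨P', hs⟩
    exact hr b hb ⟨_, .renAct hs hab⟩
  · rintro ⟨hst, hr⟩
    refine ⟨fun ⟨P', hs⟩ => ?_, ?_⟩
    · cases hs with
      | renTau hs => exact hst ⟨_, hs⟩
    · rintro b hb ⟨P', hs⟩
      cases hs with
      | renAct hs hab => exact hr _ ⟨b, hb, hab⟩ ⟨_, hs⟩

/-- `RenTrace R σ' σ`: a trace `σ'` of `P` gives rise to the trace `σ` of `R(P)`. -/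
inductive RenTrace (R : Set (ℕ × ℕ)) : PFT → PFT → Prop
  | nil : RenTrace R [] []
  | act {a b σ' σ} : (a, b) ∈ R → RenTrace R σ' σ →
      RenTrace R (Sum.inl a :: σ') (Sum.inl b :: σ)
  | refusal {X σ' σ} : RenTrace R σ' σ →
      (∀ a ρ', σ' = Sum.inl a :: ρ' → a ∈ renPreimage R X →
        ∃ b ρ, σ = Sum.inl b :: ρ ∧ b ∈ X) →
      RenTrace R (Sum.inr (renPreimage R X) :: σ') (Sum.inr X :: σ)

theorem RenTrace.of_fft {R : Set (ℕ × ℕ)} {P : Expr} {σ : PFT} (h : fft (.ren R P) σ) :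
    ∃ σ', fft P σ' ∧ RenTrace R σ' σ := by
  generalize hT : Expr.ren R P = T at h
  induction h generalizing P with
  | top => exact ⟨[], .top, .nil⟩
  | act hs _ ih =>
    subst hT
    cases hs with
    | renAct hs hab =>
      obtain ⟨σ', hf, hc⟩ := ih rfl
      exact ⟨_, .act hs hf, .act hab hc⟩
  | tau hs _ ih =>
    subst hT
    cases hs with
    | renTau hs =>
      obtain ⟨σ', hf, hc⟩ := ih rfl
      exact ⟨_, .tau hs hf, hc⟩
  | refusal hr hst _ ih =>
    subst hT
    obtain ⟨σ', hf, hc⟩ := ih rfl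
    have hP := refuses_ren_iff.1 ⟨hst, hr⟩
    refine ⟨_, .refusal hP.2 hP.1 hf, .refusal hc ?_⟩
    rintro a ρ' rfl ha
    exact absurd hf (hP.not_fft ha)
  | timeoutRef hr hst hs _ ih =>
    subst hT
    have hP := refuses_ren_iff.1 ⟨hst, hr⟩
    cases hs with
    | renTimeout hs =>
      obtain ⟨σ', hf, hc⟩ := ih rfl
      cases hc with
      | refusal hc hh => exact ⟨_, .timeoutRef hP.2 hP.1 hs hf, .refusal hc hh⟩
  | timeoutAct hr hst hs _ ha ih =>
    subst hT
    have hP := refuses_ren_iff.1 ⟨hst, hr⟩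
    cases hs with
    | renTimeout hs =>
      obtain ⟨σ', hf, hc⟩ := ih rfl
      cases hc with
      | act hab hc =>
        exact ⟨_, .timeoutAct hP.2 hP.1 hs hf ⟨_, ha, hab⟩,
          .refusal (.act hab hc) fun _ _ _ _ => ⟨_, _, rfl, ha⟩⟩

theorem RenTrace.fft_ren {R : Set (ℕ × ℕ)} {σ' σ : PFT} (hc : RenTrace R σ' σ)
    {P : Expr} (h : fft P σ') : fft (.ren R P) σ := by
  induction hc generalizing P with
  | nil => exact .top
  | act hab _ ih =>
    exact h.act_induction (M := fun P => fft (.ren R P) _)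
      (fun _ _ hs hf => .tau (.renTau hs) hf) (fun _ _ hs hf => .act (.renAct hs hab) (ih hf))
  | refusal _ hh ih =>
    refine h.refusal_induction (M := fun P => fft (.ren R P) _)
      (fun _ _ hs hf => .tau (.renTau hs) hf) ?_ ?_ ?_
    · intro P hP hf
      have hr := refuses_ren_iff.2 hP
      exact .refusal hr.2 hr.1 (ih hf)
    · intro P Q hP hs hf
      have hr := refuses_ren_iff.2 hP
      exact .timeoutRef hr.2 hr.1 (.renTimeout hs) hf
    · intro P Q a ρ' hP hs hf hσ ha
      have hr := refuses_ren_iff.2 hP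
      obtain ⟨b, ρ, rfl, hb⟩ := hh a ρ' hσ ha
      exact .timeoutAct hr.2 hr.1 (.renTimeout hs) (ih hf) hb

theorem fftSet_ren_mono {R : Set (ℕ × ℕ)} {P Q : Expr} (h : fftSet Q ⊆ fftSet P) :
    fftSet (.ren R Q) ⊆ fftSet (.ren R P) := fun _ hσ =>
  let ⟨_, hf, hc⟩ := RenTrace.of_fft hσ
  hc.fft_ren (h hf)

/-! ### Abstraction -/

theorem refuses_abs_iff {I : Set ℕ} {P : Expr} {X : Set ℕ} :
    Refuses (.abs I P) X ↔ Refuses P (X ∪ I) := by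
  constructor
  · rintro ⟨hst, hr⟩
    refine ⟨fun ⟨P', hs⟩ => hst ⟨_, .absFree hs (Act.tau_notIn I)⟩, ?_⟩
    rintro a ha ⟨P', hs⟩
    by_cases haI : a ∈ I
    · exact hst ⟨_, .absHide hs haI⟩
    · exact hr a (ha.resolve_right haI) ⟨_, .absFree hs (Act.act_notIn.2 haI)⟩
  · rintro ⟨hst, hr⟩
    refine ⟨fun ⟨P', hs⟩ => ?_, ?_⟩
    · cases hs with
      | absFree hs => exact hst ⟨_, hs⟩
      | absHide hs ha => exact hr _ (Or.inr ha) ⟨_, hs⟩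
    · rintro a ha ⟨P', hs⟩
      cases hs with
      | absFree hs => exact hr _ (Or.inl ha) ⟨_, hs⟩

/-- `AbsTrace I σ' σ`: a trace `σ'` of `P` gives rise to the trace `σ` of `τ_I(P)`. -/
inductive AbsTrace (I : Set ℕ) : PFT → PFT → Prop
  | nil : AbsTrace I [] []
  | hide {a σ' σ} : a ∈ I → AbsTrace I σ' σ → AbsTrace I (Sum.inl a :: σ') σ
  | act {a σ' σ} : a ∉ I → AbsTrace I σ' σ →
      AbsTrace I (Sum.inl a :: σ') (Sum.inl a :: σ)
  | refusal {X σ' σ} : AbsTrace I σ' σ →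
      (∀ a ρ', σ' = Sum.inl a :: ρ' → a ∈ X ∪ I → ∃ b ρ, σ = Sum.inl b :: ρ ∧ b ∈ X) →
      AbsTrace I (Sum.inr (X ∪ I) :: σ') (Sum.inr X :: σ)
  | timeout {X a σ' σ} : AbsTrace I (Sum.inl a :: σ') (Sum.inr X :: σ) →
      AbsTrace I (Sum.inr (X ∪ I) :: Sum.inl a :: σ') (Sum.inr X :: σ)

theorem AbsTrace.of_fft {I : Set ℕ} {P : Expr} {σ : PFT} (h : fft (.abs I P) σ) :
    ∃ σ', fft P σ' ∧ AbsTrace I σ' σ := by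
  generalize hT : Expr.abs I P = T at h
  induction h generalizing P with
  | top => exact ⟨[], .top, .nil⟩
  | act hs _ ih =>
    subst hT
    cases hs with
    | absFree hs hn =>
      obtain ⟨σ', hf, hc⟩ := ih rfl
      exact ⟨_, .act hs hf, .act (Act.act_notIn.1 hn) hc⟩
  | tau hs _ ih =>
    subst hT
    cases hs with
    | absFree hs =>
      obtain ⟨σ', hf, hc⟩ := ih rfl
      exact ⟨_, .tau hs hf, hc⟩
    | absHide hs ha =>
      obtain ⟨σ', hf, hc⟩ := ih rfl
      exact ⟨_, .act hs hf, .hide ha hc⟩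
  | refusal hr hst _ ih =>
    subst hT
    obtain ⟨σ', hf, hc⟩ := ih rfl
    have hP := refuses_abs_iff.1 ⟨hst, hr⟩
    refine ⟨_, .refusal hP.2 hP.1 hf, .refusal hc ?_⟩
    rintro a ρ' rfl ha
    exact absurd hf (hP.not_fft ha)
  | timeoutRef hr hst hs _ ih =>
    subst hT
    have hP := refuses_abs_iff.1 ⟨hst, hr⟩
    cases hs with
    | absFree hs =>
      obtain ⟨σ', hf, hc⟩ := ih rfl
      cases hc with
      | hide ha hc =>
        exact ⟨_, .timeoutAct hP.2 hP.1 hs hf (Or.inr ha), .timeout (.hide ha hc)⟩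
      | refusal hc hh => exact ⟨_, .timeoutRef hP.2 hP.1 hs hf, .refusal hc hh⟩
      | timeout hc => exact ⟨_, .timeoutRef hP.2 hP.1 hs hf, .timeout hc⟩
  | timeoutAct hr hst hs _ ha ih =>
    subst hT
    have hP := refuses_abs_iff.1 ⟨hst, hr⟩
    cases hs with
    | absFree hs =>
      obtain ⟨σ', hf, hc⟩ := ih rfl
      cases hc with
      | hide hi hc =>
        exact ⟨_, .timeoutAct hP.2 hP.1 hs hf (Or.inr hi),
          .refusal (.hide hi hc) fun _ _ _ _ => ⟨_, _, rfl, ha⟩⟩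
      | act hn hc =>
        exact ⟨_, .timeoutAct hP.2 hP.1 hs hf (Or.inl ha),
          .refusal (.act hn hc) fun _ _ _ _ => ⟨_, _, rfl, ha⟩⟩

theorem AbsTrace.fft_abs {I : Set ℕ} {σ' σ : PFT} (hc : AbsTrace I σ' σ)
    {P : Expr} (h : fft P σ') : fft (.abs I P) σ := by
  have tau {ρ} (P Q : Expr) (hs : Step P .tau Q) (hf : fft (.abs I Q) ρ) :
      fft (.abs I P) ρ := .tau (.absFree hs (Act.tau_notIn I)) hf
  have timeout {P Q : Expr} (hs : Step P .timeout Q) :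
      Step (.abs I P) .timeout (.abs I Q) := .absFree hs (Act.timeout_notIn I)
  induction hc generalizing P with
  | nil => exact .top
  | hide ha _ ih =>
    exact h.act_induction (M := fun P => fft (.abs I P) _) tau
      (fun _ _ hs hf => .tau (.absHide hs ha) (ih hf))
  | act ha _ ih =>
    exact h.act_induction (M := fun P => fft (.abs I P) _) tau
      (fun _ _ hs hf => .act (.absFree hs (Act.act_notIn.2 ha)) (ih hf))
  | refusal _ hh ih =>
    refine h.refusal_induction (M := fun P => fft (.abs I P) _) tau ?_ ?_ ?_
    · intro P hP hf
      have hr := refuses_abs_iff.2 hP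
      exact .refusal hr.2 hr.1 (ih hf)
    · intro P Q hP hs hf
      have hr := refuses_abs_iff.2 hP
      exact .timeoutRef hr.2 hr.1 (timeout hs) hf
    · intro P Q a ρ' hP hs hf hσ ha
      have hr := refuses_abs_iff.2 hP
      obtain ⟨b, ρ, rfl, hb⟩ := hh a ρ' hσ ha
      exact .timeoutAct hr.2 hr.1 (timeout hs) (ih hf) hb
  | timeout _ ih =>
    refine h.refusal_induction (M := fun P => fft (.abs I P) _) tau ?_ ?_ ?_
    · intro P _ hf
      exact ih hf
    · intro P Q hP hs hf
      have hr := refuses_abs_iff.2 hP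
      exact .timeoutRef hr.2 hr.1 (timeout hs) hf
    · intro P Q a ρ' hP hs hf _ _
      have hr := refuses_abs_iff.2 hP
      exact .timeoutRef hr.2 hr.1 (timeout hs) (ih hf)

theorem fftSet_abs_mono {I : Set ℕ} {P Q : Expr} (h : fftSet Q ⊆ fftSet P) :
    fftSet (.abs I Q) ⊆ fftSet (.abs I P) := fun _ hσ =>
  let ⟨_, hf, hc⟩ := AbsTrace.of_fft hσ
  hc.fft_abs (h hf)

/-! ### Parallel composition -/

/-- The actions of `X` that the environment `T` allows its partner in `_ ∥_S T` to do. -/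
def allowed (S : Set ℕ) (T : Expr) (X : Set ℕ) : Set ℕ := {a ∈ X | a ∉ S ∨ a ∈ initials T}

theorem refuses_par_iff {S : Set ℕ} {P T : Expr} {X : Set ℕ} :
    Refuses (.par S P T) X ↔ Refuses T (X \ S) ∧ Refuses P (allowed S T X) := by
  constructor
  · rintro ⟨hst, hr⟩
    refine ⟨⟨fun ⟨_, hs⟩ => hst ⟨_, .parR hs (Act.tau_notIn S)⟩, ?_⟩,
      ⟨fun ⟨_, hs⟩ => hst ⟨_, .parL hs (Act.tau_notIn S)⟩, ?_⟩⟩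
    · rintro a ⟨haX, haS⟩ ⟨_, hs⟩
      exact hr a haX ⟨_, .parR hs (Act.act_notIn.2 haS)⟩
    · rintro a ⟨haX, ha⟩ ⟨_, hs⟩
      by_cases haS : a ∈ S
      · obtain ⟨_, hs'⟩ := ha.resolve_left (not_not.2 haS)
        exact hr a haX ⟨_, .parSync hs hs' haS⟩
      · exact hr a haX ⟨_, .parL hs (Act.act_notIn.2 haS)⟩
  · rintro ⟨⟨hstT, hrT⟩, ⟨hstP, hrP⟩⟩
    refine ⟨fun ⟨_, hs⟩ => ?_, ?_⟩
    · cases hs with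
      | parL hs => exact hstP ⟨_, hs⟩
      | parR hs => exact hstT ⟨_, hs⟩
    · rintro a ha ⟨_, hs⟩
      cases hs with
      | parL hs hn => exact hrP a ⟨ha, Or.inl (Act.act_notIn.1 hn)⟩ ⟨_, hs⟩
      | parR hs hn => exact hrT a ⟨ha, Act.act_notIn.1 hn⟩ ⟨_, hs⟩
      | parSync hs hs' => exact hrP a ⟨ha, Or.inr ⟨_, hs'⟩⟩ ⟨_, hs⟩

/-- `ParTrace S T σ' σ`: a trace `σ'` of `P` gives rise, together with the behaviour
of the process `T`, to the trace `σ` of `P ∥_S T`. -/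
inductive ParTrace (S : Set ℕ) : Expr → PFT → PFT → Prop
  | nil {T} : ParTrace S T [] []
  | tau {T T' σ' σ} : Step T .tau T' → ParTrace S T' σ' σ → ParTrace S T σ' σ
  | actL {T a σ' σ} : a ∉ S → ParTrace S T σ' σ →
      ParTrace S T (Sum.inl a :: σ') (Sum.inl a :: σ)
  | actR {T T' a σ' σ} : a ∉ S → Step T (.act a) T' → ParTrace S T' σ' σ →
      ParTrace S T σ' (Sum.inl a :: σ)
  | sync {T T' a σ' σ} : a ∈ S → Step T (.act a) T' → ParTrace S T' σ' σ →
      ParTrace S T (Sum.inl a :: σ') (Sum.inl a :: σ)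
  | refusal {T X σ' σ} : Refuses T (X \ S) → ParTrace S T σ' σ →
      (∀ a ρ', σ' = Sum.inl a :: ρ' → a ∈ allowed S T X →
        ∃ b ρ, σ = Sum.inl b :: ρ ∧ b ∈ X) →
      ParTrace S T (Sum.inr (allowed S T X) :: σ') (Sum.inr X :: σ)
  | timeoutRef {T T' X σ' σ} : Refuses T (X \ S) → Step T .timeout T' →
      ParTrace S T' σ' (Sum.inr X :: σ) →
      (∀ a ρ', σ' = Sum.inl a :: ρ' → a ∉ allowed S T X) →
      ParTrace S T (Sum.inr (allowed S T X) :: σ') (Sum.inr X :: σ)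
  | timeoutAct {T T' X b σ' σ} : Refuses T (X \ S) → Step T .timeout T' →
      ParTrace S T' σ' (Sum.inl b :: σ) → b ∈ X →
      (∀ a ρ', σ' = Sum.inl a :: ρ' → a ∉ allowed S T X) →
      ParTrace S T (Sum.inr (allowed S T X) :: σ') (Sum.inr X :: Sum.inl b :: σ)

theorem ParTrace.eq_allowed_cons {S : Set ℕ} {T : Expr} {X : Set ℕ} {σ' σ : PFT}
    (hT : stable T) (h : ParTrace S T σ' (Sum.inr X :: σ)) :
    ∃ ρ', σ' = Sum.inr (allowed S T X) :: ρ' := by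
  cases h with
  | tau hs => exact absurd ⟨_, hs⟩ hT
  | refusal => exact ⟨_, rfl⟩
  | timeoutRef => exact ⟨_, rfl⟩
  | timeoutAct => exact ⟨_, rfl⟩

theorem ParTrace.eq_act_cons {S : Set ℕ} {T : Expr} {X : Set ℕ} {a : ℕ} {σ' σ : PFT}
    (hT : Refuses T (X \ S)) (ha : a ∈ X) (h : ParTrace S T σ' (Sum.inl a :: σ)) :
    a ∈ allowed S T X ∧ ∃ ρ', σ' = Sum.inl a :: ρ' := by
  cases h with
  | tau hs => exact absurd ⟨_, hs⟩ hT.1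
  | actL haS => exact ⟨⟨ha, Or.inl haS⟩, _, rfl⟩
  | actR haS hs => exact absurd ⟨_, hs⟩ (hT.2 a ⟨ha, haS⟩)
  | sync _ hs => exact ⟨⟨ha, Or.inr ⟨_, hs⟩⟩, _, rfl⟩

theorem ParTrace.of_fft {S : Set ℕ} {P T : Expr} {σ : PFT} (h : fft (.par S P T) σ) :
    ∃ σ', fft P σ' ∧ ParTrace S T σ' σ := by
  generalize hU : Expr.par S P T = U at h
  induction h generalizing P T with
  | top => exact ⟨[], .top, .nil⟩
  | act hs _ ih =>
    subst hU
    cases hs with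
    | parL hs hn =>
      obtain ⟨σ', hf, hc⟩ := ih rfl
      exact ⟨_, .act hs hf, .actL (Act.act_notIn.1 hn) hc⟩
    | parR hs hn =>
      obtain ⟨σ', hf, hc⟩ := ih rfl
      exact ⟨_, hf, .actR (Act.act_notIn.1 hn) hs hc⟩
    | parSync hs hs' ha =>
      obtain ⟨σ', hf, hc⟩ := ih rfl
      exact ⟨_, .act hs hf, .sync ha hs' hc⟩
  | tau hs _ ih =>
    subst hU
    cases hs with
    | parL hs =>
      obtain ⟨σ', hf, hc⟩ := ih rfl
      exact ⟨_, .tau hs hf, hc⟩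
    | parR hs =>
      obtain ⟨σ', hf, hc⟩ := ih rfl
      exact ⟨_, hf, .tau hs hc⟩
  | refusal hr hst _ ih =>
    subst hU
    obtain ⟨σ', hf, hc⟩ := ih rfl
    obtain ⟨hT, hP⟩ := refuses_par_iff.1 ⟨hst, hr⟩
    refine ⟨_, .refusal hP.2 hP.1 hf, .refusal hT hc ?_⟩
    rintro a ρ' rfl ha
    exact absurd hf (hP.not_fft ha)
  | timeoutRef hr hst hs _ ih =>
    subst hU
    obtain ⟨hT, hP⟩ := refuses_par_iff.1 ⟨hst, hr⟩
    cases hs with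
    | parL hs =>
      obtain ⟨σ', hf, hc⟩ := ih rfl
      obtain ⟨ρ', rfl⟩ := hc.eq_allowed_cons hT.1
      exact ⟨_, .timeoutRef hP.2 hP.1 hs hf, hc⟩
    | parR hs =>
      obtain ⟨σ', hf, hc⟩ := ih rfl
      refine ⟨_, .refusal hP.2 hP.1 hf, .timeoutRef hT hs hc ?_⟩
      rintro a ρ' rfl ha
      exact hP.not_fft ha hf
  | timeoutAct hr hst hs _ ha ih =>
    subst hU
    obtain ⟨hT, hP⟩ := refuses_par_iff.1 ⟨hst, hr⟩
    cases hs with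
    | parL hs =>
      obtain ⟨σ', hf, hc⟩ := ih rfl
      obtain ⟨haT, ρ', rfl⟩ := hc.eq_act_cons hT ha
      exact ⟨_, .timeoutAct hP.2 hP.1 hs hf haT,
        .refusal hT hc fun _ _ _ _ => ⟨_, _, rfl, ha⟩⟩
    | parR hs =>
      obtain ⟨σ', hf, hc⟩ := ih rfl
      refine ⟨_, .refusal hP.2 hP.1 hf, .timeoutAct hT hs hc ha ?_⟩
      rintro a ρ' rfl ha
      exact hP.not_fft ha hf

theorem ParTrace.fft_par {S : Set ℕ} {T : Expr} {σ' σ : PFT} (hc : ParTrace S T σ' σ)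
    {P : Expr} (h : fft P σ') : fft (.par S P T) σ := by
  have tauL {T ρ} (P Q : Expr) (hs : Step P .tau Q) (hf : fft (.par S Q T) ρ) :
      fft (.par S P T) ρ := .tau (.parL hs (Act.tau_notIn S)) hf
  have timeoutRefL {T X ρ} (hT : Refuses T (X \ S)) (P Q : Expr)
      (hP : Refuses P (allowed S T X)) (hs : Step P .timeout Q)
      (hf : fft (.par S Q T) (Sum.inr X :: ρ)) : fft (.par S P T) (Sum.inr X :: ρ) :=
    have hr := refuses_par_iff.2 ⟨hT, hP⟩
    .timeoutRef hr.2 hr.1 (.parL hs (Act.timeout_notIn S)) hf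
  induction hc generalizing P with
  | nil => exact .top
  | tau hs _ ih => exact .tau (.parR hs (Act.tau_notIn S)) (ih h)
  | @actL T _ _ _ ha _ ih =>
    exact h.act_induction (M := fun P => fft (.par S P T) _) tauL
      (fun _ _ hs hf => .act (.parL hs (Act.act_notIn.2 ha)) (ih hf))
  | actR ha hs _ ih => exact .act (.parR hs (Act.act_notIn.2 ha)) (ih h)
  | @sync T _ _ _ _ ha hs' _ ih =>
    exact h.act_induction (M := fun P => fft (.par S P T) _) tauL
      (fun _ _ hs hf => .act (.parSync hs hs' ha) (ih hf))
  | @refusal T _ _ _ hT _ hh ih =>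
    refine h.refusal_induction (M := fun P => fft (.par S P T) _) tauL ?_ (timeoutRefL hT) ?_
    · intro P hP hf
      have hr := refuses_par_iff.2 ⟨hT, hP⟩
      exact .refusal hr.2 hr.1 (ih hf)
    · intro P Q a ρ' hP hs hf hσ ha
      have hr := refuses_par_iff.2 ⟨hT, hP⟩
      obtain ⟨b, ρ, rfl, hb⟩ := hh a ρ' hσ ha
      exact .timeoutAct hr.2 hr.1 (.parL hs (Act.timeout_notIn S)) (ih hf) hb
  | @timeoutRef T _ _ _ _ hT hs' _ hh ih =>
    refine h.refusal_induction (M := fun P => fft (.par S P T) _) tauL ?_ (timeoutRefL hT) ?_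
    · intro P hP hf
      have hr := refuses_par_iff.2 ⟨hT, hP⟩
      exact .timeoutRef hr.2 hr.1 (.parR hs' (Act.timeout_notIn S)) (ih hf)
    · intro P Q a ρ' _ _ _ hσ ha
      exact absurd ha (hh a ρ' hσ)
  | @timeoutAct T _ _ _ _ _ hT hs' _ hb hh ih =>
    refine h.refusal_induction (M := fun P => fft (.par S P T) _) tauL ?_ (timeoutRefL hT) ?_
    · intro P hP hf
      have hr := refuses_par_iff.2 ⟨hT, hP⟩
      exact .timeoutAct hr.2 hr.1 (.parR hs' (Act.timeout_notIn S)) (ih hf) hb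
    · intro P Q a ρ' _ _ _ hσ ha
      exact absurd ha (hh a ρ' hσ)

theorem fftSet_par_mono_left {S : Set ℕ} {P Q T : Expr} (h : fftSet Q ⊆ fftSet P) :
    fftSet (.par S Q T) ⊆ fftSet (.par S P T) := fun _ hσ =>
  let ⟨_, hf, hc⟩ := ParTrace.of_fft hσ
  hc.fft_par (h hf)

theorem Step.par_comm {S : Set ℕ} {P Q U : Expr} {α : Act} (h : Step (.par S P Q) α U) :
    ∃ P' Q', U = .par S P' Q' ∧ Step (.par S Q P) α (.par S Q' P') := by
  cases h with
  | parL hs hn => exact ⟨_, _, rfl, .parR hs hn⟩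
  | parR hs hn => exact ⟨_, _, rfl, .parL hs hn⟩
  | parSync hs hs' ha => exact ⟨_, _, rfl, .parSync hs' hs ha⟩

theorem Refuses.par_comm {S : Set ℕ} {P Q : Expr} {X : Set ℕ}
    (h : Refuses (.par S P Q) X) : Refuses (.par S Q P) X :=
  ⟨fun ⟨_, hs⟩ => let ⟨_, _, _, hs'⟩ := hs.par_comm; h.1 ⟨_, hs'⟩,
    fun a ha ⟨_, hs⟩ => let ⟨_, _, _, hs'⟩ := hs.par_comm; h.2 a ha ⟨_, hs'⟩⟩

theorem fft.par_comm {S : Set ℕ} {P Q : Expr} {σ : PFT} (h : fft (.par S P Q) σ) :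
    fft (.par S Q P) σ := by
  generalize hU : Expr.par S P Q = U at h
  induction h generalizing P Q with
  | top => exact .top
  | act hs _ ih =>
    subst hU
    obtain ⟨_, _, rfl, hs'⟩ := hs.par_comm
    exact .act hs' (ih rfl)
  | tau hs _ ih =>
    subst hU
    obtain ⟨_, _, rfl, hs'⟩ := hs.par_comm
    exact .tau hs' (ih rfl)
  | refusal hr hst _ ih =>
    subst hU
    have hr' := Refuses.par_comm ⟨hst, hr⟩
    exact .refusal hr'.2 hr'.1 (ih rfl)
  | timeoutRef hr hst hs _ ih =>
    subst hU
    have hr' := Refuses.par_comm ⟨hst, hr⟩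
    obtain ⟨_, _, rfl, hs'⟩ := hs.par_comm
    exact .timeoutRef hr'.2 hr'.1 hs' (ih rfl)
  | timeoutAct hr hst hs _ ha ih =>
    subst hU
    have hr' := Refuses.par_comm ⟨hst, hr⟩
    obtain ⟨_, _, rfl, hs'⟩ := hs.par_comm
    exact .timeoutAct hr'.2 hr'.1 hs' (ih rfl) ha

theorem fftSet_par_mono_right {S : Set ℕ} {P Q T : Expr} (h : fftSet Q ⊆ fftSet P) :
    fftSet (.par S T Q) ⊆ fftSet (.par S T P) := fun _ hσ =>
  fft.par_comm (fftSet_par_mono_left h (fft.par_comm hσ))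

/-! ### Guarded sums -/

theorem fftSet_gsum_mono {f g : ℕ → Option (Act × Expr)}
    (hfg : ∀ i α E, g i = some (α, E) → ∃ F, f i = some (α, F) ∧ fftSet E ⊆ fftSet F)
    (hgf : ∀ i α F, f i = some (α, F) → ∃ E, g i = some (α, E)) :
    fftSet (.gsum g) ⊆ fftSet (.gsum f) := by
  have step {α E} (hs : Step (.gsum g) α E) :
      ∃ F, Step (.gsum f) α F ∧ fftSet E ⊆ fftSet F := by
    cases hs with
    | gsum hi =>
      obtain ⟨F, hF, hEF⟩ := hfg _ _ _ hi
      exact ⟨F, .gsum hF, hEF⟩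
  have step' {α F} (hs : Step (.gsum f) α F) : ∃ E, Step (.gsum g) α E := by
    cases hs with
    | gsum hi =>
      obtain ⟨E, hE⟩ := hgf _ _ _ hi
      exact ⟨E, .gsum hE⟩
  have refuses {X} (hr : Refuses (.gsum g) X) : Refuses (.gsum f) X :=
    ⟨fun ⟨_, hs⟩ => hr.1 (step' hs), fun a ha ⟨_, hs⟩ => hr.2 a ha (step' hs)⟩
  intro σ h
  change fft _ σ at h
  change fft _ σ
  generalize hU : Expr.gsum g = U at h
  induction h with
  | top => exact .top
  | act hs hf =>
    subst hU
    obtain ⟨_, hs', hEF⟩ := step hs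
    exact .act hs' (hEF hf)
  | tau hs hf =>
    subst hU
    obtain ⟨_, hs', hEF⟩ := step hs
    exact .tau hs' (hEF hf)
  | refusal hr hst _ ih =>
    subst hU
    have hr' := refuses ⟨hst, hr⟩
    exact .refusal hr'.2 hr'.1 (ih rfl)
  | timeoutRef hr hst hs hf =>
    subst hU
    have hr' := refuses ⟨hst, hr⟩
    obtain ⟨_, hs', hEF⟩ := step hs
    exact .timeoutRef hr'.2 hr'.1 hs' (hEF hf)
  | timeoutAct hr hst hs hf ha =>
    subst hU
    have hr' := refuses ⟨hst, hr⟩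
    obtain ⟨_, hs', hEF⟩ := step hs
    exact .timeoutAct hr'.2 hr'.1 hs' (hEF hf) ha

/-- The partial failure trace preorder is a precongruence for
the operators of CCSP^g_t: for every unary recursion-free CCSP^g_t-context `C`,
if `fft(P) ⊇ fft(Q)` then `fft(C[P]) ⊇ fft(C[Q])`. -/
theorem fft_precongruence_g (P Q : Expr) (hP : IsProcess P) (hQ : IsProcess Q)
    (h : fftSet Q ⊆ fftSet P) :
    ∀ C : GCtx, GCtx.OK C → fftSet (C.fill Q) ⊆ fftSet (C.fill P) := by
  intro C hC
  induction hC with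
  | hole => exact h
  | gsum _ _ ih =>
    refine fftSet_gsum_mono ?_ ?_
    · rintro (_ | i) β E hi
      · cases hi
        exact ⟨_, rfl, ih⟩
      · exact ⟨E, hi, subset_rfl⟩
    · rintro (_ | i) β F hi
      · cases hi
        exact ⟨_, rfl⟩
      · exact ⟨F, hi⟩
  | parL _ _ _ ih => exact fftSet_par_mono_left ih
  | parR _ _ _ ih => exact fftSet_par_mono_right ih
  | abs _ ih => exact fftSet_abs_mono ih
  | ren _ _ ih => exact fftSet_ren_mono ih
end

section
/- Fix an action b ∈ A. For each partial failure trace σ ∈ (A ∪ 𝒫(A))*⊤ for which b is fresh, there exists a CCSP^g_t process T_σ such that for every CCSP^g_t process P for which b is fresh: τ_{A∖{b}}(T_σ ∥_{A∖{b}} P) does not satisfy safety(b) if and only if σ ∈ fft(P). -/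
/-! ### Safety and freshness -/

/-- Reachability via the transition relation. -/
inductive Reach : Expr → Expr → Prop
  | refl (P) : Reach P P
  | step {P α Q R} : Step P α Q → Reach Q R → Reach P R

/-- The action `b` is fresh for the process `P`: no process reachable from `P`
has an outgoing `b`-transition. -/
def FreshFor (b : ℕ) (P : Expr) : Prop :=
  ∀ R, Reach P R → ∀ R', ¬ Step R (.act b) R'

/-- The action `b` is fresh for the partial failure trace `σ`: it occurs in `σ`
neither as an action nor inside a refusal set. -/
def FreshTrace (b : ℕ) (σ : PFT) : Prop :=
  Sum.inl b ∉ σ ∧ ∀ X : Set ℕ, Sum.inr X ∈ σ → b ∉ X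

/-- The canonical safety property: `P ⊨ safety(b)` iff no partial failure trace
of `P` contains the action `b`. -/
def Safety (b : ℕ) (P : Expr) : Prop := ∀ σ, fft P σ → Sum.inl b ∉ σ

/-- The guarded sum `α.E + Σ_{β ∈ S} β.0`, where the time-out action is left out of `S`. -/
noncomputable def guardedTest (α : Act) (E : Expr) (S : Set Act) : Expr :=
  open Classical in
  .gsum fun
    | 0 => some (α, E)
    | 1 => if Act.tau ∈ S then some (.tau, .nil) else none
    | n + 2 => if Act.act n ∈ S then some (.act n, .nil) else none

theorem step_nil_iff {α : Act} {F : Expr} : Step .nil α F ↔ False :=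
  ⟨(nomatch ·), False.elim⟩

theorem guardedTest_summand {α β : Act} {E F : Expr} {S : Set Act} (h : Step (guardedTest α E S) β F) :
    (β = α ∧ F = E) ∨ (β ∈ S ∧ β ≠ .timeout ∧ F = .nil) := by
  cases h with
  | @gsum _ i _ _ h =>
    rcases i with _ | _ | n <;> simp at h <;> grind

theorem step_guardedTest_iff {α β : Act} {E F : Expr} {S : Set Act} :
    Step (guardedTest α E S) β F ↔
      (β = α ∧ F = E) ∨ (β ∈ S ∧ β ≠ .timeout ∧ F = .nil) := by
  refine ⟨guardedTest_summand, ?_⟩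
  rintro (⟨rfl, rfl⟩ | ⟨hS, ht, rfl⟩)
  · exact .gsum (i := 0) rfl
  · cases β with
    | act n => exact .gsum (i := n + 2) (by simp [hS])
    | tau => exact .gsum (i := 1) (by simp [hS])
    | timeout => exact absurd rfl ht

theorem mem_initials_guardedTest_iff {α : Act} {c : ℕ} {E : Expr} {S : Set Act} :
    c ∈ initials (guardedTest α E S) ↔ .act c = α ∨ .act c ∈ S := by
  simp [initials, step_guardedTest_iff, exists_or]

theorem IsProcess.guardedTest {α : Act} {E : Expr} {S : Set Act} (h : IsProcess E) :
    IsProcess (guardedTest α E S) := by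
  refine ⟨fun x hx => ?_, .gsum fun i β F hF => ?_⟩
  · cases hx with
    | gsum hi hF =>
      rcases guardedTest_summand (.gsum hi) with ⟨-, rfl⟩ | ⟨-, -, rfl⟩
      · exact h.1 x hF
      · cases hF
  · rcases guardedTest_summand (.gsum hF) with ⟨-, rfl⟩ | ⟨-, -, rfl⟩
    exacts [h.2, .nil]

theorem NoPlus.guardedTest {α : Act} {E : Expr} {S : Set Act} (h : NoPlus E) :
    NoPlus (guardedTest α E S) := by
  refine .gsum fun i β F hF => ?_
  rcases guardedTest_summand (.gsum hF) with ⟨-, rfl⟩ | ⟨-, -, rfl⟩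
  exacts [h, .nil]

/-- The process `τ_{A∖{b}}(T ∥_{A∖{b}} P)`. -/
def testComp (b : ℕ) (T P : Expr) : Expr := .abs {a | a ≠ b} (.par {a | a ≠ b} T P)

/-- `testComp b T P` is stable. -/
def Idle (b : ℕ) (T P : Expr) : Prop :=
  stable T ∧ stable P ∧ ∀ a, a ≠ b → a ∈ initials T → a ∉ initials P

/-- `testComp b T P` can reach an occurrence of `b` performed by the test `T`,
time-outs being taken in stable states only. -/
inductive Reveals (b : ℕ) : Expr → Expr → Prop
  | now {T T' P} : Step T (.act b) T' → Reveals b T P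
  | tauL {T T' P} : Step T .tau T' → Reveals b T' P → Reveals b T P
  | tauR {T P P'} : Step P .tau P' → Reveals b T P' → Reveals b T P
  | sync {T T' P P' a} : a ≠ b → Step T (.act a) T' → Step P (.act a) P' →
      Reveals b T' P' → Reveals b T P
  | timeoutL {T T' P} : Idle b T P → Step T .timeout T' → Reveals b T' P → Reveals b T P
  | timeoutR {T P P'} : Idle b T P → Step P .timeout P' → Reveals b T P' → Reveals b T P

theorem step_testComp_tau_iff {b : ℕ} {T P C : Expr} :
    Step (testComp b T P) .tau C ↔
      (∃ T', Step T .tau T' ∧ C = testComp b T' P) ∨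
      (∃ P', Step P .tau P' ∧ C = testComp b T P') ∨
      ∃ a T' P', a ≠ b ∧ Step T (.act a) T' ∧ Step P (.act a) P' ∧ C = testComp b T' P' := by
  constructor
  · intro h
    cases h with
    | absFree h _ =>
      cases h with
      | parL h _ => exact .inl ⟨_, h, rfl⟩
      | parR h _ => exact .inr (.inl ⟨_, h, rfl⟩)
    | absHide h ha =>
      cases h with
      | parL _ hn => exact absurd ha (hn _ rfl)
      | parR _ hn => exact absurd ha (hn _ rfl)
      | parSync hT hP _ => exact .inr (.inr ⟨_, _, _, ha, hT, hP, rfl⟩)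
  · have hn (S : Set ℕ) : Act.tau.notIn S := fun a h => by cases h
    rintro (⟨T', h, rfl⟩ | ⟨P', h, rfl⟩ | ⟨a, T', P', ha, hT, hP, rfl⟩)
    · exact .absFree (.parL h (hn _)) (hn _)
    · exact .absFree (.parR h (hn _)) (hn _)
    · exact .absHide (.parSync hT hP ha) ha

theorem step_testComp_timeout_iff {b : ℕ} {T P C : Expr} :
    Step (testComp b T P) .timeout C ↔
      (∃ T', Step T .timeout T' ∧ C = testComp b T' P) ∨
      ∃ P', Step P .timeout P' ∧ C = testComp b T P' := by
  constructor
  · intro h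
    cases h with
    | absFree h _ =>
      cases h with
      | parL h _ => exact .inl ⟨_, h, rfl⟩
      | parR h _ => exact .inr ⟨_, h, rfl⟩
  · have hn (S : Set ℕ) : Act.timeout.notIn S := fun a h => by cases h
    rintro (⟨T', h, rfl⟩ | ⟨P', h, rfl⟩)
    · exact .absFree (.parL h (hn _)) (hn _)
    · exact .absFree (.parR h (hn _)) (hn _)

theorem step_testComp_act {b c : ℕ} {T P C : Expr} (h : Step (testComp b T P) (.act c) C) :
    c = b ∧ ((∃ T', Step T (.act b) T') ∨ ∃ P', Step P (.act b) P') := by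
  cases h with
  | absFree h hc =>
    obtain rfl : c = b := not_not.1 (hc c rfl)
    cases h with
    | parL h _ => exact ⟨rfl, .inl ⟨_, h⟩⟩
    | parR h _ => exact ⟨rfl, .inr ⟨_, h⟩⟩
    | parSync hT _ _ => exact ⟨rfl, .inl ⟨_, hT⟩⟩

theorem step_testComp_of_left {b : ℕ} {T T' P : Expr} (h : Step T (.act b) T') :
    Step (testComp b T P) (.act b) (testComp b T' P) := by
  have hn : (Act.act b).notIn {a | a ≠ b} := fun a h => by cases h; simp
  exact .absFree (.parL h hn) hn

theorem stable_testComp_iff {b : ℕ} {T P : Expr} : stable (testComp b T P) ↔ Idle b T P := by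
  simp only [stable, Idle, initials, step_testComp_tau_iff, Set.mem_ofPred_eq]
  grind

theorem FreshFor.step {b : ℕ} {P Q : Expr} {α : Act} (h : FreshFor b P) (hs : Step P α Q) :
    FreshFor b Q := fun R hR => h R (.step hs hR)

theorem reveals_of_fft {b : ℕ} {C : Expr} {σ : PFT} (h : fft C σ) (hb : Sum.inl b ∈ σ) {T P : Expr}
    (hC : C = testComp b T P) (hP : FreshFor b P) : Reveals b T P := by
  induction h generalizing T P with
  | top => simp at hb
  | act hs _ _ =>
    subst hC
    obtain ⟨-, ⟨T', h⟩ | ⟨P', h⟩⟩ := step_testComp_act hs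
    · exact .now h
    · exact absurd h (hP P (.refl P) P')
  | tau hs _ ih =>
    subst hC
    rcases step_testComp_tau_iff.1 hs with ⟨T', h, hC⟩ | ⟨P', h, hC⟩ | ⟨a, T', P', ha, hT, hs', hC⟩
    · exact .tauL h (ih hb hC hP)
    · exact .tauR h (ih hb hC (hP.step h))
    · exact .sync ha hT hs' (ih hb hC (hP.step hs'))
  | refusal _ _ _ ih => exact ih (by simpa using hb) hC hP
  | timeoutRef _ hst hs _ ih =>
    subst hC
    rcases step_testComp_timeout_iff.1 hs with ⟨T', h, hC⟩ | ⟨P', h, hC⟩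
    · exact .timeoutL (stable_testComp_iff.1 hst) h (ih hb hC hP)
    · exact .timeoutR (stable_testComp_iff.1 hst) h (ih hb hC (hP.step h))
  | timeoutAct _ hst hs _ _ ih =>
    subst hC
    have hb' := List.mem_of_ne_of_mem Sum.inl_ne_inr hb
    rcases step_testComp_timeout_iff.1 hs with ⟨T', h, hC⟩ | ⟨P', h, hC⟩
    · exact .timeoutL (stable_testComp_iff.1 hst) h (ih hb' hC hP)
    · exact .timeoutR (stable_testComp_iff.1 hst) h (ih hb' hC (hP.step h))

theorem fft_of_step_timeout {b : ℕ} {C D : Expr} (hst : stable C) (hs : Step C .timeout D)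
    (h : fft D [.inl b] ∨ fft D [.inr {b}, .inl b]) :
    fft C [.inl b] ∨ fft C [.inr {b}, .inl b] := by
  by_cases hb : b ∈ initials C
  · obtain ⟨C', hC⟩ := hb
    exact .inl (.act hC .top)
  · have hX : ∀ a ∈ ({b} : Set ℕ), a ∉ initials C := by simpa using hb
    exact .inr (h.elim (fun h => .timeoutAct hX hst hs h rfl) (.timeoutRef hX hst hs))

theorem Reveals.fft_testComp {b : ℕ} {T P : Expr} (h : Reveals b T P) :
    fft (testComp b T P) [.inl b] ∨ fft (testComp b T P) [.inr {b}, .inl b] := by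
  induction h with
  | now h => exact .inl (.act (step_testComp_of_left h) .top)
  | @tauL T T' P h _ ih =>
    have hs : Step (testComp b T P) .tau (testComp b T' P) :=
      step_testComp_tau_iff.2 (.inl ⟨_, h, rfl⟩)
    exact ih.imp (.tau hs) (.tau hs)
  | @tauR T P P' h _ ih =>
    have hs : Step (testComp b T P) .tau (testComp b T P') :=
      step_testComp_tau_iff.2 (.inr (.inl ⟨_, h, rfl⟩))
    exact ih.imp (.tau hs) (.tau hs)
  | @sync T T' P P' _ ha hT hP _ ih =>
    have hs : Step (testComp b T P) .tau (testComp b T' P') :=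
      step_testComp_tau_iff.2 (.inr (.inr ⟨_, _, _, ha, hT, hP, rfl⟩))
    exact ih.imp (.tau hs) (.tau hs)
  | timeoutL hi h _ ih =>
    exact fft_of_step_timeout (stable_testComp_iff.2 hi)
      (step_testComp_timeout_iff.2 (.inl ⟨_, h, rfl⟩)) ih
  | timeoutR hi h _ ih =>
    exact fft_of_step_timeout (stable_testComp_iff.2 hi)
      (step_testComp_timeout_iff.2 (.inr ⟨_, h, rfl⟩)) ih

theorem not_safety_testComp_iff {b : ℕ} {T P : Expr} (hP : FreshFor b P) :
    ¬ Safety b (testComp b T P) ↔ Reveals b T P := by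
  simp only [Safety, not_forall, not_not]
  refine ⟨fun ⟨σ, h, hb⟩ => reveals_of_fft h hb rfl hP, fun h => ?_⟩
  rcases h.fft_testComp with h | h <;> exact ⟨_, h, by simp⟩

theorem not_reveals_nil {b : ℕ} {P : Expr} : ¬ Reveals b .nil P := by
  intro h
  generalize hT : Expr.nil = T at h
  induction h <;> subst hT <;> simp_all [step_nil_iff]

theorem idle_guardedTest_iff {b : ℕ} {E P : Expr} {X : Set ℕ} (hb : b ∉ X) :
    Idle b (guardedTest .timeout E (Act.act '' X)) P ↔
      stable P ∧ ∀ a ∈ X, a ∉ initials P := by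
  simp only [Idle, stable, mem_initials_guardedTest_iff, step_guardedTest_iff]
  grind

theorem idle_guardedTest_act_iff {b a : ℕ} {E P : Expr} {X : Set ℕ} (hb : b ∉ X) (ha : a ∈ X) :
    Idle b (guardedTest (.act a) E (Act.act '' (X \ {a}))) P ↔
      stable P ∧ ∀ c ∈ X, c ∉ initials P := by
  simp only [Idle, stable, mem_initials_guardedTest_iff, step_guardedTest_iff]
  grind

/-- Against every process, the test `T` reveals `b` exactly when `σ` is a partial failure trace. -/
def Tests (b : ℕ) (T : Expr) (σ : PFT) : Prop := ∀ P, Reveals b T P ↔ fft P σ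

theorem Tests.act {b a : ℕ} {T : Expr} {ρ : PFT} (h : Tests b T ρ) (ha : a ≠ b) :
    Tests b (guardedTest (.act a) T {.tau}) (.inl a :: ρ) := by
  intro P
  constructor
  · intro hr
    generalize hT : guardedTest (.act a) T {.tau} = U at hr
    induction hr with
    | now hs => subst hT; simp [step_guardedTest_iff, ha.symm] at hs
    | tauL hs hr _ =>
      subst hT
      obtain rfl : _ = Expr.nil := by simpa [step_guardedTest_iff] using hs
      exact absurd hr not_reveals_nil
    | tauR hs _ ih => exact .tau hs (ih hT)
    | sync _ hs hs' hr _ =>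
      subst hT
      obtain ⟨rfl, rfl⟩ : _ = a ∧ _ = T := by simpa [step_guardedTest_iff] using hs
      exact .act hs' ((h _).1 hr)
    | timeoutL hi _ _ _ | timeoutR hi _ _ _ =>
      subst hT
      exact absurd ⟨_, step_guardedTest_iff.2 (.inr ⟨rfl, by simp, rfl⟩)⟩ hi.1
  · intro hf
    generalize hσ : (.inl a :: ρ : PFT) = σ at hf
    induction hf with
    | tau hs _ ih => exact .tauR hs (ih hσ)
    | act hs hf _ =>
      obtain ⟨rfl, rfl⟩ : a = _ ∧ ρ = _ := by simpa using hσ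
      exact .sync ha (step_guardedTest_iff.2 (.inl ⟨rfl, rfl⟩)) hs ((h _).2 hf)
    | top | refusal | timeoutRef | timeoutAct => simp at hσ

theorem Tests.refusal {b : ℕ} {X : Set ℕ} {T : Expr} {ρ : PFT} (h : Tests b T ρ) (hb : b ∉ X)
    (hρ : ∀ a ∈ X, ∀ ρ', ρ ≠ .inl a :: ρ') :
    Tests b (guardedTest .timeout T (Act.act '' X)) (.inr X :: ρ) := by
  intro P
  constructor
  · intro hr
    generalize hT : guardedTest .timeout T (Act.act '' X) = U at hr
    induction hr with
    | now hs => subst hT; simp [step_guardedTest_iff, hb] at hs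
    | tauL hs _ _ => subst hT; simp [step_guardedTest_iff] at hs
    | tauR hs _ ih => exact .tau hs (ih hT)
    | sync _ hs _ hr _ =>
      subst hT
      obtain ⟨-, rfl⟩ : _ ∈ X ∧ _ = Expr.nil := by simpa [step_guardedTest_iff] using hs
      exact absurd hr not_reveals_nil
    | timeoutL hi hs hr _ =>
      subst hT
      obtain rfl : _ = T := by simpa [step_guardedTest_iff] using hs
      have hP := (idle_guardedTest_iff hb).1 hi
      exact .refusal hP.2 hP.1 ((h _).1 hr)
    | timeoutR hi hs _ ih =>
      have hP := (idle_guardedTest_iff hb).1 (hT ▸ hi)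
      exact .timeoutRef hP.2 hP.1 hs (ih hT)
  · intro hf
    generalize hσ : (.inr X :: ρ : PFT) = σ at hf
    induction hf with
    | tau hs _ ih => exact .tauR hs (ih hσ)
    | refusal hX hst hf _ =>
      obtain ⟨rfl, rfl⟩ : X = _ ∧ ρ = _ := by simpa using hσ
      exact .timeoutL ((idle_guardedTest_iff hb).2 ⟨hst, hX⟩)
        (step_guardedTest_iff.2 (.inl ⟨rfl, rfl⟩)) ((h _).2 hf)
    | timeoutRef hX hst hs _ ih =>
      obtain ⟨rfl, rfl⟩ : X = _ ∧ ρ = _ := by simpa using hσ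
      exact .timeoutR ((idle_guardedTest_iff hb).2 ⟨hst, hX⟩) hs (ih rfl)
    | timeoutAct _ _ _ _ ha _ =>
      obtain ⟨rfl, rfl⟩ : X = _ ∧ ρ = _ := by simpa using hσ
      exact absurd rfl (hρ _ ha _)
    | top | act => simp at hσ

theorem Tests.fft_of_reveals_waiting {b a : ℕ} {X : Set ℕ} {T P : Expr} {ρ : PFT} (h : Tests b T ρ)
    (hb : b ∉ X) (ha : a ∈ X)
    (hr : Reveals b (guardedTest (.act a) T (Act.act '' (X \ {a}))) P) :
    fft P (.inl a :: ρ) ∨ fft P (.inr X :: .inl a :: ρ) := by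
  generalize hT : guardedTest (.act a) T (Act.act '' (X \ {a})) = U at hr
  induction hr with
  | now hs =>
    subst hT
    have hab : b ≠ a := fun e => hb (e ▸ ha)
    simp [step_guardedTest_iff, hb, hab] at hs
  | tauL hs _ _ => subst hT; simp [step_guardedTest_iff] at hs
  | tauR hs _ ih => exact (ih hT).imp (.tau hs) (.tau hs)
  | sync _ hs hs' hr _ =>
    subst hT
    rcases step_guardedTest_iff.1 hs with ⟨e, rfl⟩ | ⟨-, -, rfl⟩
    · cases e
      exact .inl (.act hs' ((h _).1 hr))
    · exact absurd hr not_reveals_nil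
  | timeoutL _ hs _ _ => subst hT; simp [step_guardedTest_iff] at hs
  | timeoutR hi hs _ ih =>
    have hP := (idle_guardedTest_act_iff hb ha).1 (hT ▸ hi)
    exact .inr ((ih hT).elim (fun hf => .timeoutAct hP.2 hP.1 hs hf ha) (.timeoutRef hP.2 hP.1 hs))

theorem Tests.reveals_waiting_of_fft {b a : ℕ} {S : Set Act} {T P : Expr} {ρ : PFT} (h : Tests b T ρ)
    (hab : a ≠ b) (hf : fft P (.inl a :: ρ)) : Reveals b (guardedTest (.act a) T S) P := by
  generalize hσ : (.inl a :: ρ : PFT) = σ at hf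
  induction hf with
  | tau hs _ ih => exact .tauR hs (ih hσ)
  | act hs hf _ =>
    obtain ⟨rfl, rfl⟩ : a = _ ∧ ρ = _ := by simpa using hσ
    exact .sync hab (step_guardedTest_iff.2 (.inl ⟨rfl, rfl⟩)) hs ((h _).2 hf)
  | top | refusal | timeoutRef | timeoutAct => simp at hσ

theorem not_fft_act {a : ℕ} {P : Expr} {ρ : PFT} (hst : stable P) (ha : a ∉ initials P) :
    ¬ fft P (.inl a :: ρ) := by
  intro h
  cases h with
  | act hs _ => exact ha ⟨_, hs⟩
  | tau hs _ => exact hst ⟨_, hs⟩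

theorem Tests.refusal_act {b a : ℕ} {X : Set ℕ} {T : Expr} {ρ : PFT} (h : Tests b T ρ)
    (hb : b ∉ X) (ha : a ∈ X) :
    Tests b (guardedTest .timeout (guardedTest (.act a) T (Act.act '' (X \ {a}))) (Act.act '' X))
      (.inr X :: .inl a :: ρ) := by
  intro P
  have hab : a ≠ b := fun e => hb (e ▸ ha)
  constructor
  · intro hr
    generalize hT : guardedTest .timeout (guardedTest (.act a) T (Act.act '' (X \ {a})))
      (Act.act '' X) = U at hr
    induction hr with
    | now hs => subst hT; simp [step_guardedTest_iff, hb] at hs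
    | tauL hs _ _ => subst hT; simp [step_guardedTest_iff] at hs
    | tauR hs _ ih => exact .tau hs (ih hT)
    | sync _ hs _ hr _ =>
      subst hT
      obtain ⟨-, rfl⟩ : _ ∈ X ∧ _ = Expr.nil := by simpa [step_guardedTest_iff] using hs
      exact absurd hr not_reveals_nil
    | timeoutL hi hs hr _ =>
      subst hT
      obtain rfl : _ = guardedTest (.act a) T (Act.act '' (X \ {a})) := by
        rcases step_guardedTest_iff.1 hs with ⟨-, e⟩ | ⟨-, e, -⟩
        exacts [e, absurd rfl e]
      have hP := (idle_guardedTest_iff hb).1 hi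
      exact (h.fft_of_reveals_waiting hb ha hr).elim (.refusal hP.2 hP.1) id
    | timeoutR hi hs _ ih =>
      have hP := (idle_guardedTest_iff hb).1 (hT ▸ hi)
      exact .timeoutRef hP.2 hP.1 hs (ih hT)
  · intro hf
    generalize hσ : (.inr X :: .inl a :: ρ : PFT) = σ at hf
    induction hf with
    | tau hs _ ih => exact .tauR hs (ih hσ)
    | refusal hX hst hf _ =>
      obtain ⟨rfl, rfl⟩ : X = _ ∧ .inl a :: ρ = _ := by simpa using hσ
      exact absurd hf (not_fft_act hst (hX a ha))
    | timeoutRef hX hst hs _ ih =>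
      obtain ⟨rfl, rfl⟩ : X = _ ∧ .inl a :: ρ = _ := by simpa using hσ
      exact .timeoutR ((idle_guardedTest_iff hb).2 ⟨hst, hX⟩) hs (ih rfl)
    | timeoutAct hX hst hs hf _ _ =>
      obtain ⟨rfl, rfl, rfl⟩ : X = _ ∧ a = _ ∧ ρ = _ := by simpa using hσ
      exact .timeoutL ((idle_guardedTest_iff hb).2 ⟨hst, hX⟩)
        (step_guardedTest_iff.2 (.inl ⟨rfl, rfl⟩))
        (.timeoutR ((idle_guardedTest_act_iff hb ha).2 ⟨hst, hX⟩) hs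
          (h.reveals_waiting_of_fft hab hf))
    | top | act => simp at hσ

theorem FreshTrace.tail {b : ℕ} {e : Elt} {ρ : PFT} (h : FreshTrace b (e :: ρ)) : FreshTrace b ρ :=
  ⟨fun hb => h.1 (.tail _ hb), fun X hX => h.2 X (.tail _ hX)⟩

theorem exists_tests (b : ℕ) : ∀ σ : PFT, FreshTrace b σ →
    ∃ T : Expr, IsProcess T ∧ NoPlus T ∧ Tests b T σ
  | [], _ =>
    ⟨.pre (.act b) .nil, ⟨fun _ => (nomatch ·), .pre .nil⟩, .pre .nil,
      fun _ => ⟨fun _ => .top, fun _ => .now .pre⟩⟩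
  | .inl a :: ρ, hσ => by
    obtain ⟨T, hT, hN, h⟩ := exists_tests b ρ hσ.tail
    have ha : a ≠ b := by
      rintro rfl
      exact hσ.1 (by simp)
    exact ⟨_, hT.guardedTest, hN.guardedTest, h.act ha⟩
  | .inr X :: ρ, hσ => by
    have hb : b ∉ X := hσ.2 X (by simp)
    by_cases hρ : ∃ a ∈ X, ∃ ρ', ρ = .inl a :: ρ'
    · obtain ⟨a, ha, ρ', rfl⟩ := hρ
      obtain ⟨T, hT, hN, h⟩ := exists_tests b ρ' hσ.tail.tail
      exact ⟨_, hT.guardedTest.guardedTest, hN.guardedTest.guardedTest, h.refusal_act hb ha⟩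
    · obtain ⟨T, hT, hN, h⟩ := exists_tests b ρ hσ.tail
      push Not at hρ
      exact ⟨_, hT.guardedTest, hN.guardedTest, h.refusal hb hρ⟩
  termination_by σ => σ.length

/-- Fix an action `b ∈ A`.  For each partial failure trace `σ`
for which `b` is fresh, there exists a CCSP^g_t process `T_σ` such that for every
CCSP^g_t process `P` for which `b` is fresh:
`τ_{A∖{b}}(T_σ ∥_{A∖{b}} P) ⊭ safety(b)` if and only if `σ ∈ fft(P)`. -/
theorem safety_testing (b : ℕ) (σ : PFT) (hσ : FreshTrace b σ) :
    ∃ T : Expr, IsProcess T ∧ NoPlus T ∧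
      ∀ P : Expr, IsProcess P → NoPlus P → FreshFor b P →
        (¬ Safety b (.abs {a | a ≠ b} (.par {a | a ≠ b} T P)) ↔ fft P σ) := by
  obtain ⟨T, hT, hN, h⟩ := exists_tests b σ hσ
  exact ⟨T, hT, hN, fun P _ _ hP => (not_safety_testComp_iff hP).trans (h P)⟩
end
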